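/- arXiv:2012.13606 — 12 statements merged into one kernel-verified Lean document; each statement's English description precedes it below -/
import Mathlib

section
/- Let R be a commutative ring and I a 2-absorbing primary ideal of R. Then Rad(I) is a 2-absorbing ideal of R. (In the paper this is stated for the e-component I_e of a graded ideal, viewed as an ideal of the ring R_e.) -/
/-- A proper ideal `I` is 2-absorbing if `a·b·c ∈ I` implies
`a·b ∈ I` or `a·c ∈ I` or `b·c ∈ I`. -/
def Ideal.IsTwoAbsorbing {R : Type*} [CommRing R] (I : Ideal R) : Prop :=
  I ≠ ⊤ ∧ ∀ a b c : R, a * b * c ∈ I → a * b ∈ I ∨ a * c ∈ I ∨ b * c ∈ I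

/-- A proper ideal `I` is 2-absorbing primary if `a·b·c ∈ I` implies
`a·b ∈ I` or `a·c ∈ Rad(I)` or `b·c ∈ Rad(I)`. -/
def Ideal.IsTwoAbsorbingPrimary {R : Type*} [CommRing R] (I : Ideal R) : Prop :=
  I ≠ ⊤ ∧ ∀ a b c : R, a * b * c ∈ I → a * b ∈ I ∨ a * c ∈ I.radical ∨ b * c ∈ I.radical

/-- A proper submodule `N` of `M` is generalized 2-absorbing (G2-absorbing) if whenever
`a·b·m ∈ N`, either `a^k·m ∈ N` for some `k ≥ 1`, or `b^k·m ∈ N` for some `k ≥ 1`,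
or `a·b ∈ (N :_R M)`. -/
def Submodule.IsG2Absorbing {R M : Type*} [CommRing R] [AddCommGroup M] [Module R M]
    (N : Submodule R M) : Prop :=
  N ≠ ⊤ ∧ ∀ (a b : R) (m : M), a • b • m ∈ N →
    (∃ k : ℕ, 1 ≤ k ∧ a ^ k • m ∈ N) ∨ (∃ k : ℕ, 1 ≤ k ∧ b ^ k • m ∈ N) ∨
      a * b ∈ N.colon ⊤

theorem stmt4 {R : Type*} [CommRing R] (I : Ideal R) (hI : I.IsTwoAbsorbingPrimary) :
    I.radical.IsTwoAbsorbing := by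
  obtain ⟨h1, h2⟩ := hI
  refine ⟨fun h => h1 (Ideal.radical_eq_top.mp h), fun a b c h => ?_⟩
  obtain ⟨n, hn⟩ := h
  rw [mul_pow, mul_pow] at hn
  have key : ∀ x : R, x ^ n ∈ I.radical → x ∈ I.radical := by
    rintro x ⟨m, hm⟩
    exact ⟨n * m, by rwa [pow_mul]⟩
  rcases h2 _ _ _ hn with h | h | h
  · exact Or.inl ⟨n, by rwa [mul_pow]⟩
  · exact Or.inr (Or.inl (key _ (by rwa [mul_pow])))
  · exact Or.inr (Or.inr (key _ (by rwa [mul_pow])))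
end

section
/- Let R be a commutative ring and M a multiplication R-module. If N is a generalized 2-absorbing (G2-absorbing) submodule of M such that Rad((N :_R M)) = (N :_R M), then N is a 2-absorbing submodule of M. (In the paper this is stated for the g-component N_g of a graded submodule, viewed as a submodule of the R_e-module M_g.) -/
/-- A proper submodule `N` of `M` is 2-absorbing if whenever `a·b·m ∈ N`, either
`a·m ∈ N` or `b·m ∈ N` or `a·b ∈ (N :_R M)`. -/
def Submodule.IsTwoAbsorbingSub {R M : Type*} [CommRing R] [AddCommGroup M] [Module R M]
    (N : Submodule R M) : Prop :=
  N ≠ ⊤ ∧ ∀ (a b : R) (m : M), a • b • m ∈ N →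
    a • m ∈ N ∨ b • m ∈ N ∨ a * b ∈ N.colon ⊤

theorem pow_smul_aux {R M : Type*} [CommRing R] [AddCommGroup M] [Module R M]
    (hmul : ∀ K : Submodule R M, K = (K.colon ⊤) • ⊤)
    (N : Submodule R M) (hrad : (N.colon ⊤).radical = N.colon ⊤)
    (a : R) (m : M) (k : ℕ) (hk : 1 ≤ k) (h : a ^ k • m ∈ N) : a • m ∈ N := by
  have hm : m ∈ Submodule.span R {m} := Submodule.mem_span_singleton_self m
  have key : ∀ x ∈ (Submodule.span R {m}).colon ⊤, a * x ∈ N.colon ⊤ := by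
    intro x hx
    rw [← hrad]
    refine ⟨k, ?_⟩
    rw [Submodule.mem_colon] at hx ⊢
    intro y hy
    obtain ⟨r, hr⟩ := Submodule.mem_span_singleton.1 (hx y hy)
    obtain ⟨j, rfl⟩ : ∃ j, k = j + 1 := ⟨k - 1, by omega⟩
    have e : (a * x) ^ (j + 1) • y = (x ^ j * r) • (a ^ (j + 1) • m) := by
      have : (a * x) ^ (j + 1) • y = (x ^ j * a ^ (j + 1)) • (x • y) := by
        rw [smul_smul]; congr 1; ring
      rw [this, ← hr, smul_smul, smul_smul]; congr 1; ring
    rw [e]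
    exact N.smul_mem _ h
  rw [hmul (Submodule.span R {m})] at hm
  have hle : (Submodule.span R {m}).colon ⊤ • (⊤ : Submodule R M) ≤
      N.comap (LinearMap.lsmul R M a) := by
    rw [Submodule.smul_le]
    intro x hx y _
    have := Submodule.mem_colon.1 (key x hx) y trivial
    rw [mul_smul, smul_comm] at this
    simpa using this
  simpa using hle hm

theorem stmt5 {R M : Type*} [CommRing R] [AddCommGroup M] [Module R M]
    (hmul : ∀ K : Submodule R M, K = (K.colon ⊤) • ⊤)
    (N : Submodule R M) (hN : N.IsG2Absorbing)
    (hrad : (N.colon ⊤).radical = N.colon ⊤) :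
    N.IsTwoAbsorbingSub := by
  refine ⟨hN.1, fun a b m h => ?_⟩
  rcases hN.2 a b m h with ⟨k, hk, h⟩ | ⟨k, hk, h⟩ | h
  · exact Or.inl (pow_smul_aux hmul N hrad a m k hk h)
  · exact Or.inr (Or.inl (pow_smul_aux hmul N hrad b m k hk h))
  · exact Or.inr (Or.inr h)
end

section
/- Let R be a commutative ring, I a 2-absorbing primary ideal of R, and J an ideal of R. If r, s ∈ R are such that r·s·J ⊆ I, then r·s ∈ I, or r·J ⊆ Rad(I), or s·J ⊆ Rad(I). (In the paper this is stated for the e-components I_e, J_e of graded ideals, viewed as ideals of the ring R_e.) -/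
theorem stmt8 {R : Type*} [CommRing R] (I : Ideal R) (hI : I.IsTwoAbsorbingPrimary)
    (J : Ideal R) (r s : R) (h : ∀ j ∈ J, r * s * j ∈ I) :
    r * s ∈ I ∨ (∀ j ∈ J, r * j ∈ I.radical) ∨ (∀ j ∈ J, s * j ∈ I.radical) := by
  by_cases hrs : r * s ∈ I
  · exact Or.inl hrs
  right
  by_contra hcon
  push Not at hcon
  obtain ⟨⟨x, hx, hrx⟩, ⟨y, hy, hsy⟩⟩ := hcon
  have key : ∀ j ∈ J, r * j ∈ I.radical ∨ s * j ∈ I.radical := fun j hj =>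
    (hI.2 r s j (h j hj)).resolve_left hrs
  have hsx := (key x hx).resolve_left hrx
  have hry := (key y hy).resolve_right hsy
  rcases key (x + y) (J.add_mem hx hy) with h1 | h1
  · rw [mul_add] at h1
    exact hrx ((Ideal.add_mem_iff_left _ hry).1 h1)
  · rw [mul_add] at h1
    exact hsy ((Ideal.add_mem_iff_right _ hsx).1 h1)
end

section
/- Let R be a Noetherian commutative ring and M a fully idempotent R-module. If N is a proper submodule of M such that (N :_R M) is a 2-absorbing primary ideal of R, then N is a generalized 2-absorbing (G2-absorbing) submodule of M. (In the paper R_e is Noetherian because R is gr-Noetherian, and the statement concerns the g-component N_g of a graded submodule of the R_e-module M_g.) -/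
/-- An `R`-module `M` is fully idempotent if every submodule `K` satisfies
`K = (K :_R M)² M`. -/
def Module.FullyIdempotent (R M : Type*) [CommRing R] [AddCommGroup M] [Module R M] : Prop :=
  ∀ K : Submodule R M, K = ((K.colon ⊤) ^ 2) • ⊤

theorem aux_pow {R M : Type*} [CommRing R] [IsNoetherianRing R] [AddCommGroup M] [Module R M]
    (N : Submodule R M) (I : Ideal R) (m : M) (h1 : I • (⊤ : Submodule R M) = Submodule.span R {m})
    (h3 : I ^ 2 • (⊤ : Submodule R M) = Submodule.span R {m}) (a : R)
    (h : ∀ c ∈ I, a * c ∈ (N.colon ⊤).radical) : ∃ k : ℕ, 1 ≤ k ∧ a ^ k • m ∈ N := by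
  have hle : Ideal.span {a} * I ≤ (N.colon ⊤).radical := by
    rw [Ideal.span_singleton_mul_le_iff]
    exact h
  obtain ⟨k, hk⟩ := Ideal.exists_pow_le_of_le_radical_of_fg hle (IsNoetherian.noetherian _)
  have hk' : (Ideal.span {a} * I) ^ (k + 1) ≤ N.colon ⊤ :=
    (Ideal.pow_le_pow_right (Nat.le_succ k)).trans hk
  have hp : ∀ n : ℕ, I ^ (n + 1) • (⊤ : Submodule R M) = Submodule.span R {m} := by
    intro n
    induction n with
    | zero => simpa using h1
    | succ n ih =>
      rw [pow_succ', ← smul_eq_mul, Submodule.smul_assoc, ih, ← h1, ← Submodule.smul_assoc,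
        smul_eq_mul, ← pow_two, h3, h1]
  refine ⟨k + 1, by omega, ?_⟩
  have hm : m ∈ I ^ (k + 1) • (⊤ : Submodule R M) := by
    rw [hp]; exact Submodule.mem_span_singleton_self m
  clear hp h1 h3
  induction hm using Submodule.smul_induction_on' with
  | smul r hr x hx =>
    rw [← mul_smul]
    refine Submodule.mem_colon.1 (hk' ?_) x trivial
    rw [mul_pow]
    exact Ideal.mul_mem_mul (Ideal.pow_mem_pow (Ideal.mem_span_singleton_self a) _) hr
  | add x hx y hy e1 e2 => rw [smul_add]; exact N.add_mem e1 e2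

theorem stmt9 {R M : Type*} [CommRing R] [IsNoetherianRing R] [AddCommGroup M] [Module R M]
    (hM : Module.FullyIdempotent R M) (N : Submodule R M) (hN : N ≠ ⊤)
    (h2 : (N.colon ⊤).IsTwoAbsorbingPrimary) :
    N.IsG2Absorbing := by
  refine ⟨hN, fun a b m hab => ?_⟩
  by_cases hJ : a * b ∈ N.colon ⊤
  · exact Or.inr (Or.inr hJ)
  have h3 := hM (Submodule.span R {m})
  set I : Ideal R := (Submodule.span R {m}).colon ⊤ with hI
  have hIM : ∀ c ∈ I, ∀ x : M, c • x ∈ Submodule.span R {m} :=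
    fun c hc x => Submodule.mem_colon.1 hc x trivial
  have h1 : I • (⊤ : Submodule R M) = Submodule.span R {m} := by
    apply le_antisymm
    · exact Submodule.smul_le.2 fun r hr x _ => hIM r hr x
    · rw [h3]
      exact Submodule.smul_mono_left (Ideal.pow_le_self two_ne_zero)
  have key : ∀ c ∈ I, a * c ∈ (N.colon ⊤).radical ∨ b * c ∈ (N.colon ⊤).radical := by
    intro c hc
    have : a * b * c ∈ N.colon ⊤ := by
      refine Submodule.mem_colon.2 fun x _ => ?_
      obtain ⟨r, hr⟩ := Submodule.mem_span_singleton.1 (hIM c hc x)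
      rw [mul_smul, ← hr, smul_comm, mul_smul]
      exact N.smul_mem r hab
    exact (h2.2 a b c this).resolve_left hJ
  have hu : (I : Set R) ⊆ (Submodule.comap (LinearMap.mulLeft R a) (N.colon ⊤).radical : Ideal R) ∪
      (Submodule.comap (LinearMap.mulLeft R b) (N.colon ⊤).radical : Ideal R) := fun c hc => key c hc
  rcases Ideal.subset_union.1 hu with h | h
  · exact Or.inl (aux_pow N I m h1 h3.symm a fun c hc => h hc)
  · exact Or.inr (Or.inl (aux_pow N I m h1 h3.symm b fun c hc => h hc))
end

section
/- Let R be a commutative ring and let I₁, I₂ be ideals of R such that I₁ is a P₁-primary ideal and I₂ is a P₂-primary ideal, where P₁ = Rad(I₁) and P₂ = Rad(I₂) are prime ideals of R. Then I₁ ∩ I₂ is a 2-absorbing primary ideal of R. (In the paper this is stated for e-components of graded ideals, viewed as ideals of the ring R_e.) -/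
theorem stmt11 {R : Type*} [CommRing R] (I₁ I₂ : Ideal R)
    (h₁ : I₁.IsPrimary) (hP₁ : I₁.radical.IsPrime)
    (h₂ : I₂.IsPrimary) (hP₂ : I₂.radical.IsPrime) :
    (I₁ ⊓ I₂).IsTwoAbsorbingPrimary := by
  have e1 : ∀ {x y : R}, x * y ∈ I₁ → x ∈ I₁ ∨ y ∈ I₁.radical :=
    fun h => (Ideal.isPrimary_iff.1 h₁).2 h
  have e2 : ∀ {x y : R}, x * y ∈ I₂ → x ∈ I₂ ∨ y ∈ I₂.radical :=
    fun h => (Ideal.isPrimary_iff.1 h₂).2 h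
  refine ⟨fun h => (Ideal.isPrimary_iff.1 h₁).1 (top_le_iff.1 (h ▸ inf_le_left)), ?_⟩
  intro a b c h
  rw [Ideal.radical_inf]
  simp only [Ideal.mem_inf] at h ⊢
  have q1 := Ideal.le_radical h.1
  have q2 := Ideal.le_radical h.2
  have f1 := e1 h.1
  have f2 := e2 h.2
  simp only [hP₁.mul_mem_iff_mem_or_mem, hP₂.mul_mem_iff_mem_or_mem] at q1 q2 ⊢
  tauto
end

section
/- Let R₁ and R₂ be commutative rings and let J be a proper ideal of the product ring R₁ × R₂. Then J is a 2-absorbing primary ideal of R₁ × R₂ if and only if either J = I₁ × R₂ for some 2-absorbing primary ideal I₁ of R₁, or J = R₁ × I₂ for some 2-absorbing primary ideal I₂ of R₂, or J = I₁ × I₂ for some primary ideal I₁ of R₁ and some primary ideal I₂ of R₂. (In the paper this is stated for the e-component of a graded ideal of a product of graded rings.) -/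
theorem aux_rad {R S : Type*} [CommRing R] [CommRing S] (I : Ideal R) (J : Ideal S) (x : R × S) :
    x ∈ (I.prod J).radical ↔ x.1 ∈ I.radical ∧ x.2 ∈ J.radical := by
  rw [Ideal.prod, Ideal.radical_inf, ← Ideal.comap_radical, ← Ideal.comap_radical]
  rfl

theorem stmt12 {R₁ R₂ : Type*} [CommRing R₁] [CommRing R₂]
    (J : Ideal (R₁ × R₂)) (hJ : J ≠ ⊤) :
    J.IsTwoAbsorbingPrimary ↔
      (∃ I₁ : Ideal R₁, I₁.IsTwoAbsorbingPrimary ∧ J = I₁.prod ⊤) ∨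
      (∃ I₂ : Ideal R₂, I₂.IsTwoAbsorbingPrimary ∧ J = (⊤ : Ideal R₁).prod I₂) ∨
      (∃ (I₁ : Ideal R₁) (I₂ : Ideal R₂), I₁.IsPrimary ∧ I₂.IsPrimary ∧ J = I₁.prod I₂) := by
  obtain ⟨I₁, I₂, rfl⟩ : ∃ (I₁ : Ideal R₁) (I₂ : Ideal R₂), J = I₁.prod I₂ :=
    ⟨_, _, Ideal.ideal_prod_eq J⟩
  constructor
  · rintro ⟨-, h⟩
    by_cases h1 : I₁ = ⊤
    · subst h1
      refine Or.inr (Or.inl ⟨I₂, ⟨?_, ?_⟩, rfl⟩)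
      · rintro rfl
        exact hJ Ideal.prod_top_top
      · intro a b c habc
        have := h (1, a) (1, b) (1, c) (by simpa [Ideal.mem_prod] using habc)
        simpa [Ideal.mem_prod, aux_rad, Ideal.radical_top] using this
    by_cases h2 : I₂ = ⊤
    · subst h2
      refine Or.inl ⟨I₁, ⟨h1, ?_⟩, rfl⟩
      intro a b c habc
      have := h (a, 1) (b, 1) (c, 1) (by simpa [Ideal.mem_prod] using habc)
      simpa [Ideal.mem_prod, aux_rad, Ideal.radical_top] using this
    have r1 : (1 : R₁) ∉ I₁.radical := fun h' =>
      h1 (Ideal.radical_eq_top.1 ((Ideal.eq_top_iff_one _).2 h'))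
    have r2 : (1 : R₂) ∉ I₂.radical := fun h' =>
      h2 (Ideal.radical_eq_top.1 ((Ideal.eq_top_iff_one _).2 h'))
    refine Or.inr (Or.inr ⟨I₁, I₂, Ideal.isPrimary_iff.2 ⟨h1, ?_⟩,
      Ideal.isPrimary_iff.2 ⟨h2, ?_⟩, rfl⟩)
    · intro x y hxy
      have := h (x, 1) (1, 0) (y, 1) (by simpa [Ideal.mem_prod] using hxy)
      simpa [Ideal.mem_prod, aux_rad, r2] using this
    · intro x y hxy
      have := h (1, x) (0, 1) (1, y) (by simpa [Ideal.mem_prod] using hxy)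
      simpa [Ideal.mem_prod, aux_rad, r1] using this
  · intro h
    refine ⟨hJ, ?_⟩
    rintro ⟨a, a'⟩ ⟨b, b'⟩ ⟨c, c'⟩ habc
    rcases h with ⟨K, ⟨-, hK⟩, e⟩ | ⟨K, ⟨-, hK⟩, e⟩ | ⟨K, L, hK, hL, e⟩
    · rw [e] at habc ⊢
      have := hK a b c (by simpa [Ideal.mem_prod] using habc)
      simpa [Ideal.mem_prod, aux_rad, Ideal.radical_top] using this
    · rw [e] at habc ⊢
      have := hK a' b' c' (by simpa [Ideal.mem_prod] using habc)
      simpa [Ideal.mem_prod, aux_rad, Ideal.radical_top] using this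
    · rw [e] at habc ⊢
      have pK := Ideal.isPrime_radical hK
      have pL := Ideal.isPrime_radical hL
      have kK := (Ideal.isPrimary_iff.1 hK).2 (x := a * b) (y := c)
      have kL := (Ideal.isPrimary_iff.1 hL).2 (x := a' * b') (y := c')
      have lK := @Ideal.le_radical _ _ K (a * b)
      have lL := @Ideal.le_radical _ _ L (a' * b')
      simp only [Prod.mk_mul_mk, Ideal.mem_prod, aux_rad] at habc ⊢
      rw [pK.mul_mem_iff_mem_or_mem] at lK
      rw [pL.mul_mem_iff_mem_or_mem] at lL
      simp only [pK.mul_mem_iff_mem_or_mem, pL.mul_mem_iff_mem_or_mem]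
      tauto
end

section
/- Let R be a commutative ring, M a multiplication R-module, and N a proper submodule of M. Then N is a primary submodule of M if and only if (N :_R M) is a primary ideal of R. (In the paper this is stated for the g-component N_g of a graded submodule, viewed as a submodule of the R_e-module M_g.) -/
/-- A proper submodule `N` of `M` is primary if whenever `a·m ∈ N`, either `m ∈ N` or
`a ∈ Rad((N :_R M))`. -/
def Submodule.IsPrimarySub {R M : Type*} [CommRing R] [AddCommGroup M] [Module R M]
    (N : Submodule R M) : Prop :=
  N ≠ ⊤ ∧ ∀ (a : R) (m : M), a • m ∈ N → m ∈ N ∨ a ∈ (N.colon ⊤).radical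

theorem stmt13 {R M : Type*} [CommRing R] [AddCommGroup M] [Module R M]
    (hmul : ∀ K : Submodule R M, K = (K.colon ⊤) • ⊤)
    (N : Submodule R M) (hN : N ≠ ⊤) :
    N.IsPrimarySub ↔ (N.colon ⊤).IsPrimary := by
  have key : ∀ r : R, r ∈ N.colon ⊤ ↔ ∀ m : M, r • m ∈ N := by
    intro r
    rw [Submodule.mem_colon]
    exact ⟨fun h m => h m trivial, fun h m _ => h m⟩
  rw [Ideal.isPrimary_iff]
  constructor
  · rintro ⟨-, h⟩
    refine ⟨?_, ?_⟩
    · intro ht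
      apply hN
      rw [eq_top_iff]
      intro m _
      have h1 : (1 : R) ∈ N.colon ⊤ := by rw [ht]; trivial
      simpa using (key 1).1 h1 m
    · intro x y hxy
      by_cases hy : y ∈ (N.colon ⊤).radical
      · exact Or.inr hy
      · refine Or.inl ((key x).2 fun m => ?_)
        refine (h y (x • m) ?_).resolve_right hy
        rw [smul_smul, mul_comm]
        exact (key _).1 hxy m
  · rintro ⟨-, h⟩
    refine ⟨hN, fun a m ham => ?_⟩
    by_cases ha : a ∈ (N.colon ⊤).radical
    · exact Or.inr ha
    · left
      have hm : m ∈ Submodule.span R {m} := Submodule.mem_span_singleton_self m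
      rw [hmul (Submodule.span R {m})] at hm
      refine (Submodule.smul_le.2 ?_ : _ ≤ N) hm
      intro r hr n _
      have hr2 : r ∈ N.colon ⊤ := by
        refine (h (x := r) (y := a) ((key _).2 fun k => ?_)).resolve_right ha
        have hk : r • k ∈ Submodule.span R {m} := Submodule.mem_colon.1 hr k trivial
        obtain ⟨c, hc⟩ := Submodule.mem_span_singleton.1 hk
        rw [mul_comm, mul_smul, ← hc, smul_comm]
        exact N.smul_mem c ham
      exact (key r).1 hr2 n
end

section
/- Let R₁, R₂ be Noetherian commutative rings, M₁ an R₁-module and M₂ an R₂-module, and suppose M₁ × M₂ is a fully idempotent module over R₁ × R₂ (componentwise action). Let N₁ be a submodule of M₁ and N₂ a submodule of M₂ with N₁ × N₂ proper in M₁ × M₂. Then N₁ × N₂ is a generalized 2-absorbing (G2-absorbing) submodule of the (R₁ × R₂)-module M₁ × M₂ if and only if either N₁ = M₁ and N₂ is a G2-absorbing submodule of M₂, or N₂ = M₂ and N₁ is a G2-absorbing submodule of M₁, or N₁ and N₂ are primary submodules of M₁ and M₂ respectively. (In the paper this is stated for g-components of graded submodules over the identity components of gr-Noetherian graded rings.)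 -/
/-- `M₁` as a module over `R₁ × R₂` via the first projection, so that the product
module `M₁ × M₂` carries the componentwise action `(a₁,a₂)·(m₁,m₂) = (a₁·m₁, a₂·m₂)`. -/
instance moduleProdFst {R₁ R₂ M₁ : Type*} [CommRing R₁] [CommRing R₂]
    [AddCommGroup M₁] [Module R₁ M₁] : Module (R₁ × R₂) M₁ :=
  Module.compHom M₁ (RingHom.fst R₁ R₂)

/-- `M₂` as a module over `R₁ × R₂` via the second projection. -/
instance moduleProdSnd {R₁ R₂ M₂ : Type*} [CommRing R₁] [CommRing R₂]
    [AddCommGroup M₂] [Module R₂ M₂] : Module (R₁ × R₂) M₂ :=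
  Module.compHom M₂ (RingHom.snd R₁ R₂)

/-- The product `N₁ × N₂` of a submodule `N₁` of `M₁` and a submodule `N₂` of `M₂`,
as a submodule of the `(R₁ × R₂)`-module `M₁ × M₂`. -/
def Submodule.prodProd {R₁ R₂ M₁ M₂ : Type*} [CommRing R₁] [CommRing R₂]
    [AddCommGroup M₁] [AddCommGroup M₂] [Module R₁ M₁] [Module R₂ M₂]
    (N₁ : Submodule R₁ M₁) (N₂ : Submodule R₂ M₂) :
    Submodule (R₁ × R₂) (M₁ × M₂) where
  carrier := (N₁ : Set M₁) ×ˢ (N₂ : Set M₂)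
  add_mem' h h' := ⟨N₁.add_mem h.1 h'.1, N₂.add_mem h.2 h'.2⟩
  zero_mem' := ⟨N₁.zero_mem, N₂.zero_mem⟩
  smul_mem' c x hx := ⟨N₁.smul_mem c.1 hx.1, N₂.smul_mem c.2 hx.2⟩

theorem aux_idem {R M : Type*} [CommRing R] [AddCommGroup M] [Module R M]
    (h : Module.FullyIdempotent R M) (N : Submodule R M) (a : R) (n : ℕ)
    (ha : ∀ x : M, a ^ n • x ∈ N) (x : M) : a • x ∈ N := by
  set K : Submodule R M := Ideal.span {a} • ⊤ with hK
  have hJ : K.colon ⊤ • (⊤ : Submodule R M) ≤ K := by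
    rw [Submodule.smul_le]
    intro r hr y _
    exact Submodule.mem_colon.1 hr y trivial
  have h1 : K ≤ Ideal.span {a} • K := by
    calc K = (K.colon ⊤) ^ 2 • (⊤ : Submodule R M) := h K
      _ = K.colon ⊤ • (K.colon ⊤ • (⊤ : Submodule R M)) := by
        rw [pow_two, Submodule.mul_smul]
      _ ≤ K.colon ⊤ • K := smul_mono_right _ hJ
      _ = Ideal.span {a} • (K.colon ⊤ • (⊤ : Submodule R M)) := by
        conv_lhs => rw [hK]
        rw [← Submodule.mul_smul, ← Submodule.mul_smul, mul_comm]
      _ ≤ _ := smul_mono_right _ hJ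
  have h2 : ∀ n : ℕ, K ≤ Ideal.span {a} ^ n • K := by
    intro n
    induction n with
    | zero => simp
    | succ k ih =>
      rw [pow_succ, Submodule.mul_smul]
      exact ih.trans (smul_mono_right _ h1)
  have h3 : a • x ∈ K := Submodule.smul_mem_smul (Ideal.mem_span_singleton_self a) trivial
  have h4 := h2 n h3
  have h5 : Ideal.span {a} ^ n • K ≤ N := by
    rw [Ideal.span_singleton_pow, Submodule.smul_le]
    intro r hr y _
    obtain ⟨c, rfl⟩ := Ideal.mem_span_singleton'.1 hr
    rw [mul_smul]
    exact N.smul_mem c (ha y)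
  exact h5 h4

theorem aux_mem {R₁ R₂ M₁ M₂ : Type*} [CommRing R₁] [CommRing R₂]
    [AddCommGroup M₁] [AddCommGroup M₂] [Module R₁ M₁] [Module R₂ M₂]
    (N₁ : Submodule R₁ M₁) (N₂ : Submodule R₂ M₂) (x : M₁ × M₂) :
    x ∈ N₁.prodProd N₂ ↔ x.1 ∈ N₁ ∧ x.2 ∈ N₂ := Iff.rfl

theorem aux_smul {R₁ R₂ M₁ M₂ : Type*} [CommRing R₁] [CommRing R₂]
    [AddCommGroup M₁] [AddCommGroup M₂] [Module R₁ M₁] [Module R₂ M₂]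
    (a : R₁ × R₂) (x : M₁ × M₂) :
    a • x = (a.1 • x.1, a.2 • x.2) := rfl

theorem aux_colon {R M : Type*} [CommRing R] [AddCommGroup M] [Module R M]
    (N : Submodule R M) (a : R) : a ∈ N.colon ⊤ ↔ ∀ x : M, a • x ∈ N := by
  rw [Submodule.mem_colon]
  exact ⟨fun h x => h x trivial, fun h x _ => h x⟩

theorem stmt14 {R₁ R₂ M₁ M₂ : Type*} [CommRing R₁] [CommRing R₂]
    [IsNoetherianRing R₁] [IsNoetherianRing R₂]
    [AddCommGroup M₁] [AddCommGroup M₂] [Module R₁ M₁] [Module R₂ M₂]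
    (hfi : Module.FullyIdempotent (R₁ × R₂) (M₁ × M₂))
    (N₁ : Submodule R₁ M₁) (N₂ : Submodule R₂ M₂)
    (hproper : N₁.prodProd N₂ ≠ ⊤) :
    (N₁.prodProd N₂).IsG2Absorbing ↔
      (N₁ = ⊤ ∧ N₂.IsG2Absorbing) ∨ (N₂ = ⊤ ∧ N₁.IsG2Absorbing) ∨
        (N₁.IsPrimarySub ∧ N₂.IsPrimarySub) := by
  have prim1 : N₁.IsPrimarySub → ∀ (a : R₁) (m : M₁), a • m ∈ N₁ → m ∈ N₁ ∨ ∀ x, a • x ∈ N₁ := by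
    intro h a m ham
    refine (h.2 a m ham).imp_right fun ⟨n, hn⟩ x => ?_
    rw [aux_colon] at hn
    have := aux_idem hfi (N₁.prodProd ⊤) (a, 0) n
      (fun y => ⟨hn y.1, trivial⟩) (x, 0)
    exact this.1
  have prim2 : N₂.IsPrimarySub → ∀ (a : R₂) (m : M₂), a • m ∈ N₂ → m ∈ N₂ ∨ ∀ x, a • x ∈ N₂ := by
    intro h a m ham
    refine (h.2 a m ham).imp_right fun ⟨n, hn⟩ x => ?_
    rw [aux_colon] at hn
    have := aux_idem hfi (Submodule.prodProd ⊤ N₂) (0, a) n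
      (fun y => ⟨trivial, hn y.2⟩) (0, x)
    exact this.2
  constructor
  · rintro ⟨-, h⟩
    simp only [aux_colon, aux_mem, aux_smul, Prod.forall, Prod.fst_mul, Prod.snd_mul,
      Prod.pow_fst, Prod.pow_snd] at h
    by_cases h1 : N₁ = ⊤
    · left
      refine ⟨h1, fun h2 => hproper ?_, fun a b m hm => ?_⟩
      · subst h1 h2
        exact eq_top_iff.2 fun x _ => ⟨trivial, trivial⟩
      · rcases h 1 a 1 b 0 m ⟨by simp, hm⟩ with ⟨k, hk, h⟩ | ⟨k, hk, h⟩ | h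
        · exact Or.inl ⟨k, hk, h.2⟩
        · exact Or.inr (Or.inl ⟨k, hk, h.2⟩)
        · exact Or.inr (Or.inr ((aux_colon _ _).2 fun x => (h 0 x).2))
    by_cases h2 : N₂ = ⊤
    · right; left
      refine ⟨h2, h1, fun a b m hm => ?_⟩
      rcases h a 1 b 1 m 0 ⟨hm, by simp⟩ with ⟨k, hk, h⟩ | ⟨k, hk, h⟩ | h
      · exact Or.inl ⟨k, hk, h.1⟩
      · exact Or.inr (Or.inl ⟨k, hk, h.1⟩)
      · exact Or.inr (Or.inr ((aux_colon _ _).2 fun x => (h x 0).1))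
    right; right
    refine ⟨⟨h1, fun a m hm => ?_⟩, ⟨h2, fun a m hm => ?_⟩⟩
    · obtain ⟨y, hy⟩ : ∃ y, y ∉ N₂ := by
        by_contra! hc
        exact h2 (eq_top_iff.2 fun x _ => hc x)
      rcases h a 1 1 0 m y ⟨by simpa using hm, by simp⟩ with ⟨k, hk, h⟩ | ⟨k, hk, h⟩ | h
      · exact absurd (by simpa using h.2) hy
      · exact Or.inl (by simpa using h.1)
      · exact Or.inr (Ideal.le_radical ((aux_colon _ _).2 fun x => by simpa using (h x 0).1))
    · obtain ⟨y, hy⟩ : ∃ y, y ∉ N₁ := by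
        by_contra! hc
        exact h1 (eq_top_iff.2 fun x _ => hc x)
      rcases h 1 a 0 1 y m ⟨by simp, by simpa using hm⟩ with ⟨k, hk, h⟩ | ⟨k, hk, h⟩ | h
      · exact absurd (by simpa using h.1) hy
      · exact Or.inl (by simpa using h.2)
      · exact Or.inr (Ideal.le_radical ((aux_colon _ _).2 fun x => by simpa using (h 0 x).2))
  · intro h
    refine ⟨hproper, ?_⟩
    simp only [aux_colon, aux_mem, aux_smul, Prod.forall, Prod.fst_mul, Prod.snd_mul,
      Prod.pow_fst, Prod.pow_snd]
    rintro a₁ a₂ b₁ b₂ m₁ m₂ ⟨hm₁, hm₂⟩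
    rcases h with ⟨rfl, -, h⟩ | ⟨rfl, -, h⟩ | ⟨h1, h2⟩
    · have h3 := h a₂ b₂ m₂ hm₂
      rw [aux_colon] at h3
      simpa using h3
    · have h3 := h a₁ b₁ m₁ hm₁
      rw [aux_colon] at h3
      simpa using h3
    · have t1 : (∀ x, a₁ • x ∈ N₁) ∨ m₁ ∈ N₁ ∨ (∀ x, b₁ • x ∈ N₁) := by
        rcases prim1 h1 _ _ hm₁ with h | h
        · exact Or.inr (prim1 h1 _ _ h)
        · exact Or.inl h
      have t2 : (∀ x, a₂ • x ∈ N₂) ∨ m₂ ∈ N₂ ∨ (∀ x, b₂ • x ∈ N₂) := by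
        rcases prim2 h2 _ _ hm₂ with h | h
        · exact Or.inr (prim2 h2 _ _ h)
        · exact Or.inl h
      have A : a₁ • m₁ ∈ N₁ → a₂ • m₂ ∈ N₂ →
          ∃ k : ℕ, 1 ≤ k ∧ a₁ ^ k • m₁ ∈ N₁ ∧ a₂ ^ k • m₂ ∈ N₂ :=
        fun p q => ⟨1, le_rfl, by simpa using p, by simpa using q⟩
      have B : b₁ • m₁ ∈ N₁ → b₂ • m₂ ∈ N₂ →
          ∃ k : ℕ, 1 ≤ k ∧ b₁ ^ k • m₁ ∈ N₁ ∧ b₂ ^ k • m₂ ∈ N₂ :=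
        fun p q => ⟨1, le_rfl, by simpa using p, by simpa using q⟩
      rcases t1 with p | p | p <;> rcases t2 with q | q | q
      · exact Or.inl (A (p _) (q _))
      · exact Or.inl (A (p _) (N₂.smul_mem _ q))
      · refine Or.inr (Or.inr fun x y => ⟨?_, ?_⟩)
        · rw [mul_smul]; exact p _
        · rw [mul_smul]; exact N₂.smul_mem _ (q _)
      · exact Or.inl (A (N₁.smul_mem _ p) (q _))
      · exact Or.inl (A (N₁.smul_mem _ p) (N₂.smul_mem _ q))
      · exact Or.inr (Or.inl (B (N₁.smul_mem _ p) (q _)))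
      · refine Or.inr (Or.inr fun x y => ⟨?_, ?_⟩)
        · rw [mul_smul]; exact N₁.smul_mem _ (p _)
        · rw [mul_smul]; exact q _
      · exact Or.inr (Or.inl (B (p _) (N₂.smul_mem _ q)))
      · exact Or.inr (Or.inl (B (p _) (q _)))
end

section
/- Let R be a commutative ring and I a 2-absorbing ideal of R. Then there are at most two prime ideals of R that are minimal over I; that is, if P, Q, P' are prime ideals each minimal over I, then P = Q or P = P' or Q = P'. (In the paper this is stated for the e-component I_e of a graded ideal, viewed as an ideal of the ring R_e.) -/
/-- `P` is a minimal prime ideal over `I`: `P` is prime, `I ⊆ P`, and there is no prime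
ideal `Q` with `I ⊆ Q` and `Q` strictly contained in `P`. -/
def Ideal.IsMinimalPrimeOver {R : Type*} [CommRing R] (I P : Ideal R) : Prop :=
  P.IsPrime ∧ I ≤ P ∧ ¬ ∃ Q : Ideal R, Q.IsPrime ∧ I ≤ Q ∧ Q < P

theorem aux_exists {R : Type*} [CommRing R] {I P : Ideal R} (hP : I.IsMinimalPrimeOver P)
    {x : R} (hx : x ∈ P) : ∃ s, s ∉ P ∧ ∃ n : ℕ, s * x ^ n ∈ I := by
  obtain ⟨hp, hle, hmin⟩ := hP
  by_contra! hcon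
  have hd : Disjoint (I : Set R) ((P.primeCompl ⊔ Submonoid.powers x : Submonoid R) : Set R) := by
    rw [Set.disjoint_left]
    intro z hz hz'
    obtain ⟨s, hs, w, ⟨n, rfl⟩, rfl⟩ := Submonoid.mem_sup.1 hz'
    exact hcon s hs n hz
  obtain ⟨Q, hQ, hIQ, hdQ⟩ := Ideal.exists_le_prime_disjoint I _ hd
  rw [Set.disjoint_left] at hdQ
  refine hmin ⟨Q, hQ, hIQ, lt_of_le_of_ne ?_ ?_⟩
  · intro z hz
    by_contra hzP
    exact hdQ hz ((le_sup_left : P.primeCompl ≤ P.primeCompl ⊔ Submonoid.powers x) hzP)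
  · rintro rfl
    exact hdQ hx ((le_sup_right : Submonoid.powers x ≤ Q.primeCompl ⊔ Submonoid.powers x)
      (Submonoid.mem_powers x))

theorem aux_ne {R : Type*} [CommRing R] {I P Q : Ideal R} (hP : I.IsMinimalPrimeOver P)
    (hQ : I.IsMinimalPrimeOver Q) (h : P ≠ Q) : ¬ P ≤ Q := fun hle =>
  hQ.2.2 ⟨P, hP.1, hP.2.1, lt_of_le_of_ne hle h⟩

theorem aux_pair {R : Type*} [CommRing R] {I P Q T : Ideal R} (hI : I.IsTwoAbsorbing)
    (hP : I.IsMinimalPrimeOver P) (hQ : I.IsMinimalPrimeOver Q) (hT : I.IsMinimalPrimeOver T)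
    (h1 : P ≠ Q) (h2 : P ≠ T) :
    ∃ a s, a ∉ Q ∧ a ∉ T ∧ s ∉ P ∧ s ∈ Q ∧ s * a ∈ I := by
  have hn : ¬ ((P : Set R) ⊆ Q ∪ T) := by
    rw [Ideal.subset_union]
    rintro (h | h)
    · exact aux_ne hP hQ h1 h
    · exact aux_ne hP hT h2 h
  obtain ⟨a, haP, ha⟩ := Set.not_subset.1 hn
  have haQ : a ∉ Q := fun h => ha (Or.inl h)
  have haT : a ∉ T := fun h => ha (Or.inr h)
  obtain ⟨s, hs, n, hsn⟩ := aux_exists hP haP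
  have hsa : s * a ∈ I := by
    induction n with
    | zero => exact I.mul_mem_right _ (by simpa using hsn)
    | succ k ih =>
      have h3 : s * a * a ^ k ∈ I := by rwa [pow_succ', ← mul_assoc] at hsn
      rcases hI.2 _ _ _ h3 with h | h | h
      · exact h
      · exact ih h
      · rw [← pow_succ'] at h
        exact absurd (hQ.1.mem_of_pow_mem _ (hQ.2.1 h)) haQ
  exact ⟨a, s, haQ, haT, hs, (hQ.1.mem_or_mem (hQ.2.1 hsa)).resolve_right haQ, hsa⟩

theorem stmt16 {R : Type*} [CommRing R] (I : Ideal R) (hI : I.IsTwoAbsorbing)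
    (P Q P' : Ideal R) (hP : I.IsMinimalPrimeOver P) (hQ : I.IsMinimalPrimeOver Q)
    (hP' : I.IsMinimalPrimeOver P') :
    P = Q ∨ P = P' ∨ Q = P' := by
  by_contra! hc
  obtain ⟨h1, h2, h3⟩ := hc
  obtain ⟨a, s, haQ, haT, hsP, hsQ, hsa⟩ := aux_pair hI hP hQ hP' h1 h2
  obtain ⟨b, t, hbP, hbT, htQ, htP, htb⟩ := aux_pair hI hQ hP hP' h1.symm h3
  have hm : a * b * (s + t) ∈ I := by
    have := I.add_mem (I.mul_mem_left b hsa) (I.mul_mem_left a htb)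
    convert this using 1
    ring
  rcases hI.2 _ _ _ hm with h | h | h
  · exact (hP'.1.mem_or_mem (hP'.2.1 h)).elim haT hbT
  · exact (hQ.1.mem_or_mem (hQ.2.1 h)).elim haQ fun h => htQ ((Q.add_mem_iff_right hsQ).1 h)
  · exact (hP.1.mem_or_mem (hP.2.1 h)).elim hbP fun h => hsP ((P.add_mem_iff_left htP).1 h)
end

section
/- Let R be a commutative ring and I a 2-absorbing primary ideal of R. Then either Rad(I) is a prime ideal of R, or Rad(I) = P₁ ∩ P₂ where P₁ and P₂ are the only two distinct prime ideals of R that are minimal over I. (In the paper this is stated for the e-component I_e of a graded ideal, viewed as an ideal of the ring R_e.) -/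
theorem aux_three {R : Type*} [CommRing R] (J : Ideal R) (hr : J.IsRadical)
    (h : ∀ a b c : R, a * b * c ∈ J → a * b ∈ J ∨ a * c ∈ J ∨ b * c ∈ J)
    (u v w : R) (huv : u * v ∈ J) (huw : u * w ∈ J) (hvw : v * w ∈ J) :
    u ∈ J ∨ v ∈ J ∨ w ∈ J := by
  have key : ∀ t s : R, s ∈ J → t * t + s ∈ J → t ∈ J := by
    intro t s hs ht
    have h2 : t * t ∈ J := (Submodule.add_mem_iff_left J hs).1 ht
    exact hr ⟨2, by rwa [pow_two]⟩
  have hs : u * v + u * w + v * w ∈ J := J.add_mem (J.add_mem huv huw) hvw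
  have h0 : (u + v) * (u + w) * (v + w) ∈ J := by
    have : (u + v) * (u + w) * (v + w) =
        (u + v) * (u * v) + (u + w) * (u * w) + (v + w) * (v * w) + (2 * w) * (u * v) := by ring
    rw [this]
    exact J.add_mem (J.add_mem (J.add_mem (J.mul_mem_left _ huv) (J.mul_mem_left _ huw))
      (J.mul_mem_left _ hvw)) (J.mul_mem_left _ huv)
  rcases h _ _ _ h0 with h1 | h1 | h1
  · exact Or.inl (key u _ hs (by convert h1 using 1; ring))
  · exact Or.inr (Or.inl (key v _ hs (by convert h1 using 1; ring)))
  · exact Or.inr (Or.inr (key w _ hs (by convert h1 using 1; ring)))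

theorem aux_prime {R : Type*} [CommRing R] (J : Ideal R) (hr : J.IsRadical)
    (h : ∀ a b c : R, a * b * c ∈ J → a * b ∈ J ∨ a * c ∈ J ∨ b * c ∈ J)
    (x y : R) (hxy : x * y ∈ J) (hx : x ∉ J) (hy : y ∉ J) :
    ∃ P : Ideal R, P.IsPrime ∧ ∀ z, z ∈ P ↔ z * x ∈ J := by
  let P : Ideal R :=
    { carrier := {z | z * x ∈ J}
      add_mem' := by
        intro a b ha hb
        simp only [Set.mem_setOf_eq] at *
        rw [add_mul]; exact J.add_mem ha hb
      zero_mem' := by simp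
      smul_mem' := by
        intro c a ha
        simp only [Set.mem_setOf_eq, smul_eq_mul] at *
        rw [mul_assoc]; exact J.mul_mem_left _ ha }
  have hP : ∀ z, z ∈ P ↔ z * x ∈ J := fun z => Iff.rfl
  refine ⟨P, ⟨?_, ?_⟩, hP⟩
  · intro ht
    have : (1 : R) ∈ P := ht ▸ Submodule.mem_top
    rw [hP, one_mul] at this
    exact hx this
  · intro a b hab
    rw [hP] at hab
    rw [hP, hP]
    rcases h _ _ _ hab with h1 | h1 | h1
    · rcases aux_three J hr h (a * x) (b * x) y
        (by convert J.mul_mem_left (x * x) h1 using 1; ring)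
        (by convert J.mul_mem_left a hxy using 1; ring)
        (by convert J.mul_mem_left b hxy using 1; ring) with h2 | h2 | h2
      · exact Or.inl h2
      · exact Or.inr h2
      · exact absurd h2 hy
    · exact Or.inl h1
    · exact Or.inr h1

theorem stmt17 {R : Type*} [CommRing R] (I : Ideal R) (hI : I.IsTwoAbsorbingPrimary) :
    I.radical.IsPrime ∨
      ∃ P₁ P₂ : Ideal R, P₁ ≠ P₂ ∧ I.IsMinimalPrimeOver P₁ ∧ I.IsMinimalPrimeOver P₂ ∧
        I.radical = P₁ ⊓ P₂ ∧ ∀ Q : Ideal R, I.IsMinimalPrimeOver Q → Q = P₁ ∨ Q = P₂ := by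
  obtain ⟨hne, hI⟩ := hI
  have hr : I.radical.IsRadical := Ideal.radical_isRadical I
  have h : ∀ a b c : R, a * b * c ∈ I.radical →
      a * b ∈ I.radical ∨ a * c ∈ I.radical ∨ b * c ∈ I.radical := by
    rintro a b c ⟨n, hn⟩
    rw [mul_pow, mul_pow] at hn
    rcases hI _ _ _ hn with h1 | h1 | h1
    · exact Or.inl ⟨n, by rwa [mul_pow]⟩
    · exact Or.inr (Or.inl (hr ⟨n, by rwa [mul_pow]⟩))
    · exact Or.inr (Or.inr (hr ⟨n, by rwa [mul_pow]⟩))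
  have hIJ : I ≤ I.radical := Ideal.le_radical
  have hJtop : I.radical ≠ ⊤ := fun ht => hne (Ideal.radical_eq_top.1 ht)
  have hmin : ∀ Q : Ideal R, Q.IsPrime → I ≤ Q → I.radical ≤ Q :=
    fun Q hQ hle => hQ.radical_le_iff.2 hle
  generalize I.radical = J at *
  by_cases hp : J.IsPrime
  · exact Or.inl hp
  right
  have : ∃ x y : R, x * y ∈ J ∧ x ∉ J ∧ y ∉ J := by
    by_contra! hcon
    exact hp ⟨hJtop, fun {x y} hxy => or_iff_not_imp_left.2 (hcon x y hxy)⟩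
  obtain ⟨x, y, hxy, hx, hy⟩ := this
  have hyx : y * x ∈ J := by rwa [mul_comm]
  obtain ⟨P₁, hP₁, h₁⟩ := aux_prime J hr h x y hxy hx hy
  obtain ⟨P₂, hP₂, h₂⟩ := aux_prime J hr h y x hyx hy hx
  have hy1 : y ∈ P₁ := (h₁ y).2 hyx
  have hx2 : x ∈ P₂ := (h₂ x).2 hxy
  have hx1 : x ∉ P₁ := fun hc => hx (hr ⟨2, by rw [pow_two]; exact (h₁ x).1 hc⟩)
  have hy2 : y ∉ P₂ := fun hc => hy (hr ⟨2, by rw [pow_two]; exact (h₂ y).1 hc⟩)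
  have hJ1 : J ≤ P₁ := fun z hz => (h₁ z).2 (J.mul_mem_right _ hz)
  have hJ2 : J ≤ P₂ := fun z hz => (h₂ z).2 (J.mul_mem_right _ hz)
  have hJ : J = P₁ ⊓ P₂ := by
    refine le_antisymm (le_inf hJ1 hJ2) ?_
    rintro z ⟨hz1, hz2⟩
    rcases aux_three J hr h z x y ((h₁ z).1 hz1) ((h₂ z).1 hz2) hxy with h3 | h3 | h3
    · exact h3
    · exact absurd h3 hx
    · exact absurd h3 hy
  have hQ : ∀ Q : Ideal R, Q.IsPrime → I ≤ Q → P₁ ≤ Q ∨ P₂ ≤ Q := by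
    intro Q hQ hle
    have := hmin Q hQ hle
    rw [hJ] at this
    exact hQ.inf_le.1 this
  refine ⟨P₁, P₂, fun he => hx1 (he ▸ hx2), ⟨hP₁, hIJ.trans hJ1, ?_⟩,
    ⟨hP₂, hIJ.trans hJ2, ?_⟩, hJ, ?_⟩
  · rintro ⟨Q, hQp, hle, hlt⟩
    rcases hQ Q hQp hle with h3 | h3
    · exact absurd hlt (not_lt_of_ge h3)
    · exact hx1 (hlt.le (h3 hx2))
  · rintro ⟨Q, hQp, hle, hlt⟩
    rcases hQ Q hQp hle with h3 | h3
    · exact hy2 (hlt.le (h3 hy1))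
    · exact absurd hlt (not_lt_of_ge h3)
  · rintro Q ⟨hQp, hle, hm⟩
    rcases hQ Q hQp hle with h3 | h3
    · left
      by_contra hne'
      exact hm ⟨P₁, hP₁, hIJ.trans hJ1, lt_of_le_of_ne h3 (Ne.symm hne')⟩
    · right
      by_contra hne'
      exact hm ⟨P₂, hP₂, hIJ.trans hJ2, lt_of_le_of_ne h3 (Ne.symm hne')⟩
end

section
/- Let R be a Noetherian commutative ring, M an R-module, and N a generalized 2-absorbing (G2-absorbing) submodule of M. If m ∈ M \ N, then either Rad((N :_R m)) is a prime ideal of R, or there exist r ∈ R \ Rad((N :_R m)) and n ≥ 1 such that Rad((N :_R r^n·m)) is a prime ideal of R. (In the paper R_e is Noetherian because R is gr-Noetherian, and the statement concerns the g-component N_g of a graded submodule of the R_e-module M_g.) -/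
/-- The ideal `(N :_R m) = {a ∈ R : a • m ∈ N}`. -/
def Submodule.colonElt {R M : Type*} [CommRing R] [AddCommGroup M] [Module R M]
    (N : Submodule R M) (m : M) : Ideal R where
  carrier := {a : R | a • m ∈ N}
  add_mem' {a b} ha hb := by simpa [add_smul] using N.add_mem ha hb
  zero_mem' := by simp
  smul_mem' c a ha := by simpa [smul_eq_mul, mul_smul] using N.smul_mem c ha

theorem stmt18 {R M : Type*} [CommRing R] [IsNoetherianRing R] [AddCommGroup M] [Module R M]
    (N : Submodule R M) (hN : N.IsG2Absorbing) (m : M) (hm : m ∉ N) :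
    (N.colonElt m).radical.IsPrime ∨
      ∃ r : R, r ∉ (N.colonElt m).radical ∧
        ∃ n : ℕ, 1 ≤ n ∧ (N.colonElt (r ^ n • m)).radical.IsPrime := by
  right
  set I := N.colonElt m with hI
  have memI : ∀ a, a ∈ I ↔ a • m ∈ N := fun a => Iff.rfl
  have h1 : (1 : R) ∉ I.radical := by
    rintro ⟨k, hk⟩
    rw [one_pow, memI, one_smul] at hk
    exact hm hk
  obtain ⟨P, ⟨r, hr, rfl⟩, hmax⟩ := set_has_maximal_iff_noetherian.mpr
    (inferInstance : IsNoetherian R R)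
    {P : Ideal R | ∃ r, r ∉ I.radical ∧ P = Submodule.colonElt I.radical r}
    ⟨_, 1, h1, rfl⟩
  have memP : ∀ s x : R, x ∈ Submodule.colonElt I.radical s ↔ x * s ∈ I.radical :=
    fun _ _ => Iff.rfl
  have hP : (Submodule.colonElt I.radical r).IsPrime := by
    refine ⟨fun h => hr ?_, fun {x y} hxy => ?_⟩
    · have : (1 : R) ∈ Submodule.colonElt I.radical r := by rw [h]; trivial
      simpa [memP] using this
    · by_contra! hcon
      obtain ⟨hx, hy⟩ := hcon
      rw [memP] at hx hy hxy
      refine hmax _ ⟨y * r, hy, rfl⟩ (lt_of_le_of_ne ?_ ?_)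
      · intro z hz
        rw [memP] at hz ⊢
        have := I.radical.mul_mem_left y hz
        rwa [show y * (z * r) = z * (y * r) by ring] at this
      · intro h
        apply hx
        rw [← memP, h, memP, ← mul_assoc]
        exact hxy
  obtain ⟨n, hn⟩ := I.exists_radical_pow_le_of_fg (IsNoetherian.noetherian _)
  refine ⟨r, hr, n + 1, by omega, ?_⟩
  convert hP using 1
  have key : ∀ x : R, x ∈ N.colonElt (r ^ (n + 1) • m) ↔ x * r ^ (n + 1) ∈ I := by
    intro x
    rw [memI, mul_smul]; rfl
  ext x
  rw [memP]
  constructor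
  · rintro ⟨k, hk⟩
    rw [key] at hk
    refine ⟨k + (n + 1), ?_⟩
    have := I.mul_mem_left (x ^ (n + 1) * r ^ k) hk
    convert this using 1
    ring
  · intro hx
    refine ⟨n + 1, ?_⟩
    rw [key, ← mul_pow, pow_succ]
    exact I.mul_mem_right _ (hn (Ideal.pow_mem_pow hx n))
end

section
/- Let R be a Noetherian commutative ring, M an R-module, and N, N₁, …, N_n submodules of M with n ≥ 2 such that N ⊆ N₁ ∪ N₂ ∪ … ∪ N_n. Suppose that at most two of N₁, …, N_n are not generalized 2-absorbing (G2-absorbing) submodules of M, and that for all i ≠ k and every m ∈ M \ N_k one has Rad((N_i :_R M)) ⊄ Rad((N_k :_R m)). Then N ⊆ N_i for some i ∈ {1, …, n}. (In the paper R_e is Noetherian because R is gr-Noetherian, and the statement concerns g-components of graded submodules of the R_e-module M_g.) -/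
theorem stmt19 {R M : Type*} [CommRing R] [IsNoetherianRing R] [AddCommGroup M] [Module R M]
    (n : ℕ) (hn : 2 ≤ n) (N : Submodule R M) (Ns : Fin n → Submodule R M)
    (hcover : ∀ x ∈ N, ∃ i : Fin n, x ∈ Ns i)
    (htwo : ∃ i j : Fin n, ∀ k : Fin n, ¬ (Ns k).IsG2Absorbing → k = i ∨ k = j)
    (hrad : ∀ i k : Fin n, i ≠ k → ∀ m : M, m ∉ Ns k →
      ¬ ((Ns i).colon ⊤).radical ≤ ((Ns k).colonElt m).radical) :
    ∃ i : Fin n, N ≤ Ns i := by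
  classical
  obtain ⟨S, hS⟩ := exists_minimal_of_wellFoundedLT
    (fun S : Finset (Fin n) => ∀ x ∈ N, ∃ i ∈ S, x ∈ Ns i)
    ⟨Finset.univ, fun x hx => by
      obtain ⟨i, hi⟩ := hcover x hx
      exact ⟨i, Finset.mem_univ i, hi⟩⟩
  have hSc := hS.prop
  obtain ⟨k, hk, -⟩ := hSc 0 N.zero_mem
  by_contra hcon
  push Not at hcon
  -- an element of `N` lying only in `Ns k`
  obtain ⟨x, hxN, hx⟩ : ∃ x ∈ N, ∀ i ∈ S.erase k, x ∉ Ns i := by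
    by_contra h
    push Not at h
    have h1 := hS.le_of_le h (Finset.erase_subset k S)
    exact Finset.notMem_erase k S (h1 hk)
  have hxk : x ∈ Ns k := by
    obtain ⟨i, hi, hxi⟩ := hSc x hxN
    by_cases hik : i = k
    · exact hik ▸ hxi
    · exact absurd hxi (hx i (Finset.mem_erase.2 ⟨hik, hi⟩))
  have key : ∀ y ∈ N, (∀ i ∈ S.erase k, y ∈ Ns i) → y ∈ Ns k := by
    intro y hyN hy
    obtain ⟨i, hi, hxi⟩ := hSc (x + y) (N.add_mem hxN hyN)
    by_cases hik : i = k
    · subst hik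
      exact ((Ns i).add_mem_iff_right hxk).1 hxi
    · have hi' : i ∈ S.erase k := Finset.mem_erase.2 ⟨hik, hi⟩
      exact absurd (((Ns i).add_mem_iff_left (hy i hi')).1 hxi) (hx i hi')
  obtain ⟨m, hmN, hmk⟩ := SetLike.not_le_iff_exists.1 (hcon k)
  -- an element of `N` with prime colon ideal
  let Q := (Ns k).comap N.subtype
  have hne : Q.mkQ ⟨m, hmN⟩ ≠ 0 := by
    intro h
    exact hmk ((Submodule.Quotient.mk_eq_zero Q).1 h)
  obtain ⟨P, hP, -⟩ := exists_le_isAssociatedPrime_of_isNoetherianRing R _ hne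
  obtain ⟨hPp, z, hz⟩ := isAssociatedPrime_iff.1 hP
  obtain ⟨⟨m', hm'N⟩, rfl⟩ := Q.mkQ_surjective z
  have hPm : ∀ r : R, r ∈ P ↔ r • m' ∈ Ns k := by
    intro r
    rw [hz, Submodule.mem_colon_singleton, Submodule.mem_bot, ← map_smul]
    exact Submodule.Quotient.mk_eq_zero Q
  have hPe : (Ns k).colonElt m' = P := by
    ext r
    exact (hPm r).symm
  have hm'k : m' ∉ Ns k := by
    intro h
    exact hPp.ne_top ((Ideal.eq_top_iff_one P).2 ((hPm 1).2 (by simpa using h)))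
  have hinf : (S.erase k).inf (fun i => (Ns i).colon ⊤) ≤ P := by
    intro r hr
    rw [Submodule.mem_finsetInf] at hr
    exact (hPm r).2 (key _ (N.smul_mem r hm'N)
      fun i hi => Submodule.mem_colon.1 (hr i hi) m' trivial)
  obtain ⟨i, hi, hiP⟩ := (Ideal.IsPrime.inf_le' hPp).1 hinf
  refine hrad i k (Finset.ne_of_mem_erase hi) m' hm'k ?_
  rw [hPe]
  exact Ideal.radical_mono hiP
end
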